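/- Let 1/2 < α ≤ 1 and let θ⁰ ∈ X^{1−2α}(ℝ²) with ‖θ⁰‖_{X^{1−2α}} < 1/4. If θ ∈ C([0,∞), X^{1−2α}(ℝ²)) ∩ L¹_loc([0,∞), X^1(ℝ²)) satisfies the integral (Duhamel) formulation of (QG)_α with k = 1, then for all t ≥ 0: ‖θ(t)‖_{X^{1−2α}} + ((1 − 4‖θ⁰‖_{X^{1−2α}})/2) ∫_0^t ‖θ(s)‖_{X^1} ds ≤ ‖θ⁰‖_{X^{1−2α}}. -/

import Mathlib

open MeasureTheory Real Filter Set

noncomputable section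

/-- Frequency space `ℝ²`. We work on the Fourier side: `F` denotes `f̂`. -/
abbrev E2 := EuclideanSpace ℝ (Fin 2)

/-- The `X^σ` norm: `‖f‖_{X^σ} = ∫ |ξ|^σ |f̂(ξ)| dξ`. -/
noncomputable def Xnorm (σ : ℝ) (F : E2 → ℂ) : ℝ := ∫ ξ : E2, ‖ξ‖ ^ σ * ‖F ξ‖

/-- Membership in `X^σ`: `ξ ↦ |ξ|^σ f̂(ξ)` is integrable. -/
def MemX (σ : ℝ) (F : E2 → ℂ) : Prop :=
  Integrable (fun ξ : E2 => ‖ξ‖ ^ σ * ‖F ξ‖)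

/-- Fourier transform of the velocity `u = R^⊥θ = (-R₂θ, R₁θ)`:
`û₀(η) = (η₁/|η|)θ̂(η)`, `û₁(η) = -(η₀/|η|)θ̂(η)`. -/
noncomputable def uhat (Θ : E2 → ℂ) (j : Fin 2) (η : E2) : ℂ :=
  if j = 0 then ((η 1 / ‖η‖ : ℝ) : ℂ) * Θ η else ((-(η 0) / ‖η‖ : ℝ) : ℂ) * Θ η

/-- Fourier transform of the nonlinearity `∇·(uθ)`:
`B̂(ξ) = i ∑ⱼ ξⱼ (ûⱼ * θ̂)(ξ)`. -/
noncomputable def Bhat (Θ : E2 → ℂ) (ξ : E2) : ℂ :=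
  Complex.I * ∑ j : Fin 2, (ξ j : ℂ) * ∫ η : E2, uhat Θ j (ξ - η) * Θ η

/-! ### Joint measurability from one-discontinuity sections -/

lemma tendsto_ceil_mul_div_succ {t : ℝ} (ht : 0 ≤ t) :
    Tendsto (fun n : ℕ => (⌈t * ((n : ℝ) + 1)⌉₊ : ℝ) / ((n : ℝ) + 1)) atTop (nhds t) := by
  have h : Tendsto (fun n : ℕ => (n : ℝ) + 1) atTop atTop :=
    tendsto_atTop_add_const_right _ _ tendsto_natCast_atTop_atTop
  exact (tendsto_nat_ceil_mul_div_atTop ht).comp h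

/-- A family of a.e.-measurable functions each of whose time sections has at most one
discontinuity agrees, in almost every section, with a jointly measurable function. -/
lemma exists_measurable_version {E : Type*} [MeasurableSpace E] {μ : Measure E} [SFinite μ]
    {f : ℝ → E → ENNReal} (hmeas : ∀ t, 0 ≤ t → AEMeasurable (f t) μ)
    (hcont : ∀ ξ s t, 0 < s → s < t →
      ContinuousAt (fun r => f r ξ) s ∨ ContinuousAt (fun r => f r ξ) t) :
    ∃ g : ℝ × E → ENNReal, Measurable g ∧
      (∀ᵐ ξ ∂μ, ∀ᵐ t ∂(volume.restrict (Ioi (0 : ℝ))), g (t, ξ) = f t ξ) ∧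
      (∀ᵐ t ∂(volume.restrict (Ioi (0 : ℝ))), ∀ᵐ ξ ∂μ, g (t, ξ) = f t ξ) := by
  have hnn : ∀ n k : ℕ, (0 : ℝ) ≤ (k : ℝ) / ((n : ℝ) + 1) := fun n k => by positivity
  obtain ⟨u, hu_meas, hu_eq⟩ : ∃ u : ℕ → ℕ → E → ENNReal, (∀ n k, Measurable (u n k)) ∧
      ∀ᵐ ξ ∂μ, ∀ n k : ℕ, f ((k : ℝ) / ((n : ℝ) + 1)) ξ = u n k ξ := by
    refine ⟨fun n k => (hmeas _ (hnn n k)).mk, fun n k => (hmeas _ (hnn n k)).measurable_mk, ?_⟩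
    rw [ae_all_iff]; intro n
    rw [ae_all_iff]; intro k
    exact (hmeas _ (hnn n k)).ae_eq_mk
  let g : ℝ × E → ENNReal :=
    fun p => limsup (fun n : ℕ => u n ⌈p.1 * ((n : ℝ) + 1)⌉₊ p.2) atTop
  have hg_meas : Measurable g := by
    refine Measurable.limsup fun n => ?_
    have h1 : Measurable (fun q : ℕ × E => u n q.1 q.2) :=
      measurable_from_prod_countable_right fun k => hu_meas n k
    have h2 : Measurable (fun p : ℝ × E => (⌈p.1 * ((n : ℝ) + 1)⌉₊, p.2)) :=
      (Nat.measurable_ceil.comp (measurable_fst.mul_const _)).prodMk measurable_snd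
    exact h1.comp h2
  have hg_eq : ∀ᵐ ξ ∂μ, ∀ t, 0 < t → ContinuousAt (fun r => f r ξ) t → g (t, ξ) = f t ξ := by
    filter_upwards [hu_eq] with ξ hξ t ht hc
    refine Tendsto.limsup_eq ?_
    have := hc.tendsto.comp (tendsto_ceil_mul_div_succ ht.le)
    refine this.congr fun n => ?_
    exact hξ n _
  refine ⟨g, hg_meas, ?_, ?_⟩
  · filter_upwards [hg_eq] with ξ hξ
    have hsub : {t : ℝ | 0 < t ∧ g (t, ξ) ≠ f t ξ}.Subsingleton := by
      rintro s ⟨hs, hs'⟩ t ⟨ht, ht'⟩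
      rcases lt_trichotomy s t with h | h | h
      · rcases hcont ξ s t hs h with hc | hc
        exacts [absurd (hξ s hs hc) hs', absurd (hξ t ht hc) ht']
      · exact h
      · rcases hcont ξ t s ht h with hc | hc
        exacts [absurd (hξ t ht hc) ht', absurd (hξ s hs hc) hs']
    rw [ae_restrict_iff' measurableSet_Ioi, ae_iff]
    refine measure_mono_null ?_ (hsub.measure_zero volume)
    intro t ht
    simpa [Classical.not_imp] using ht
  · have hcount := Measure.countable_meas_pos_of_disjoint_iUnion₀ (μ := μ)
      (As := fun t : Ioi (0 : ℝ) => {ξ | g (t, ξ) = f t ξ}ᶜ)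
      (fun t => (nullMeasurableSet_eq_fun
        (hg_meas.comp measurable_prodMk_left).aemeasurable (hmeas t (mem_Ioi.1 t.2).le)).compl)
      (by
        intro s t hst
        refine measure_mono_null ?_ (ae_iff.1 hg_eq)
        rintro ξ ⟨h1, h2⟩ h
        rcases lt_or_gt_of_ne hst with hlt | hlt
        · rcases hcont ξ s t s.2 hlt with hc | hc
          exacts [h1 (h s s.2 hc), h2 (h t t.2 hc)]
        · rcases hcont ξ t s t.2 hlt with hc | hc
          exacts [h2 (h t t.2 hc), h1 (h s s.2 hc)])
    rw [ae_restrict_iff' measurableSet_Ioi, ae_iff]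
    refine measure_mono_null ?_ ((hcount.image Subtype.val).measure_zero volume)
    intro t ht
    simp only [Classical.not_imp, mem_ofPred_eq] at ht
    obtain ⟨h0, h1⟩ := ht
    refine ⟨⟨t, h0⟩, ?_, rfl⟩
    rw [ae_iff] at h1
    exact pos_iff_ne_zero.2 h1

/-- The primitive of an arbitrary function has at most one positive discontinuity: the time at
which integrability is lost. -/
lemma continuousAt_primitive_or {k : ℝ → ℂ} {s t : ℝ} (hs : 0 < s) (hst : s < t) :
    ContinuousAt (fun r => ∫ x in (0 : ℝ)..r, k x) s ∨
      ContinuousAt (fun r => ∫ x in (0 : ℝ)..r, k x) t := by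
  obtain ⟨m, hsm, hmt⟩ := exists_between hst
  by_cases h : IntervalIntegrable k volume 0 m
  · left
    have := intervalIntegral.continuousOn_primitive_interval' h (a := 0) left_mem_uIcc
    refine this.continuousAt ?_
    rw [uIcc_of_le (hs.trans hsm).le]
    exact Icc_mem_nhds hs hsm
  · right
    have : (fun r => ∫ x in (0 : ℝ)..r, k x) =ᶠ[nhds t] fun _ => 0 := by
      filter_upwards [Ioi_mem_nhds hmt] with r hr
      refine intervalIntegral.integral_undef fun h' => h (h'.mono_set ?_)
      rw [uIcc_of_le (hs.trans hsm).le, uIcc_of_le ((hs.trans hsm).trans hr).le]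
      exact Icc_subset_Icc_right (le_of_lt hr)
    exact continuousAt_const.congr this.symm

/-! ### The scalar Duhamel formula -/

lemma ofReal_exp_add_lintegral_Icc {m r t : ℝ} (hm : 0 ≤ m) (hrt : r ≤ t) :
    ENNReal.ofReal (Real.exp (-(t - r) * m)) +
      ENNReal.ofReal m * ∫⁻ s in Icc r t, ENNReal.ofReal (Real.exp (-(s - r) * m)) = 1 := by
  have hc : Continuous fun s : ℝ => Real.exp (-(s - r) * m) := by fun_prop
  have hd : ∀ s ∈ uIcc r t, HasDerivAt (fun s => -Real.exp (-(s - r) * m))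
      (m * Real.exp (-(s - r) * m)) s := by
    intro s _
    have := (((((hasDerivAt_id s).sub_const r).neg).mul_const m).exp).neg
    exact this.congr_deriv (by simp; ring)
  have hint := intervalIntegral.integral_eq_sub_of_hasDerivAt hd
    ((hc.const_mul m).intervalIntegrable _ _)
  rw [intervalIntegral.integral_const_mul, intervalIntegral.integral_of_le hrt,
    ← integral_Icc_eq_integral_Ioc] at hint
  rw [← ofReal_integral_eq_lintegral_ofReal (hc.integrableOn_Icc)
    (ae_of_all _ fun s => (Real.exp_pos _).le), ← ENNReal.ofReal_mul hm, hint,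
    ← ENNReal.ofReal_add (Real.exp_pos _).le]
  · simp
  · rw [← hint]
    exact mul_nonneg hm (integral_nonneg fun s => (Real.exp_pos _).le)

/-- `y + m ∫ y = a + ∫ h` for the solution `y` of `y' + m y = h`, `y 0 = a`. -/
lemma duhamel_add_lintegral {m t : ℝ} (hm : 0 ≤ m) (ht : 0 ≤ t) (a : ENNReal) {h : ℝ → ENNReal}
    (hh : Measurable h) {y : ℝ → ENNReal}
    (hy : ∀ t, 0 ≤ t → y t = ENNReal.ofReal (Real.exp (-t * m)) * a +
      ∫⁻ s in Ioc 0 t, ENNReal.ofReal (Real.exp (-(t - s) * m)) * h s) :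
    y t + ENNReal.ofReal m * ∫⁻ s in Ioc 0 t, y s = a + ∫⁻ s in Ioc 0 t, h s := by
  set e : ℝ → ENNReal := fun x => ENNReal.ofReal (Real.exp (-x * m)) with he
  have he_meas : Measurable e := by rw [he]; fun_prop
  have hint : ∫⁻ s in Ioc 0 t, y s = (∫⁻ s in Ioc 0 t, e s) * a +
      ∫⁻ s in Ioc 0 t, ∫⁻ r in Ioc 0 s, e (s - r) * h r := by
    rw [← lintegral_mul_const _ he_meas, ← lintegral_add_left (he_meas.mul_const a)]
    exact setLIntegral_congr_fun measurableSet_Ioc fun s hs => hy s hs.1.le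
  have hswap : ∫⁻ s in Ioc 0 t, ∫⁻ r in Ioc 0 s, e (s - r) * h r =
      ∫⁻ r in Ioc 0 t, (∫⁻ s in Icc r t, e (s - r)) * h r := by
    have h1 : ∀ s ∈ Ioc 0 t, ∫⁻ r in Ioc 0 s, e (s - r) * h r =
        ∫⁻ r in Ioc 0 t, {p : ℝ × ℝ | p.2 ≤ p.1}.indicator
          (fun p => e (p.1 - p.2) * h p.2) (s, r) := by
      intro s hs
      rw [← lintegral_indicator measurableSet_Ioc, ← lintegral_indicator measurableSet_Ioc]
      refine lintegral_congr fun r => ?_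
      simp only [indicator, mem_Ioc, mem_ofPred_eq]
      split_ifs with h1 h2 h3 h4 h5 <;> first | rfl | exfalso
      · exact h3 h1.2
      · exact h2 ⟨h1.1, h1.2.trans hs.2⟩
      · exact h1 ⟨h4.1, h5⟩
    have h2 : ∀ r ∈ Ioc 0 t, ∫⁻ s in Ioc 0 t, {p : ℝ × ℝ | p.2 ≤ p.1}.indicator
          (fun p => e (p.1 - p.2) * h p.2) (s, r) =
        (∫⁻ s in Icc r t, e (s - r)) * h r := by
      intro r hr
      rw [← lintegral_mul_const _ (by fun_prop), ← lintegral_indicator measurableSet_Icc,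
        ← lintegral_indicator measurableSet_Ioc]
      refine lintegral_congr fun s => ?_
      simp only [indicator, mem_Ioc, mem_Icc, mem_ofPred_eq]
      split_ifs with h1 h2 h3 h4 h5 <;> first | rfl | exfalso
      · exact h3 ⟨h2, h1.2⟩
      · exact h2 h4.1
      · exact h1 ⟨hr.1.trans_le h5.1, h5.2⟩
    rw [setLIntegral_congr_fun measurableSet_Ioc h1, lintegral_lintegral_swap,
      setLIntegral_congr_fun measurableSet_Ioc h2]
    refine Measurable.aemeasurable (Measurable.indicator ?_ ?_)
    · fun_prop
    · exact measurableSet_le measurable_snd measurable_fst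
  have hcomb : (∫⁻ r in Ioc 0 t, e (t - r) * h r) +
      ENNReal.ofReal m * ∫⁻ r in Ioc 0 t, (∫⁻ s in Icc r t, e (s - r)) * h r =
      ∫⁻ r in Ioc 0 t, h r := by
    rw [← lintegral_const_mul' _ _ ENNReal.ofReal_ne_top, ← lintegral_add_left (by fun_prop)]
    refine setLIntegral_congr_fun measurableSet_Ioc fun r hr => ?_
    have := ofReal_exp_add_lintegral_Icc hm hr.2
    simp only [he]
    rw [← mul_assoc, ← add_mul, this, one_mul]
  have hzero : e t + ENNReal.ofReal m * ∫⁻ s in Ioc 0 t, e s = 1 := by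
    have := ofReal_exp_add_lintegral_Icc hm ht
    simpa [he, restrict_Ioc_eq_restrict_Icc] using this
  rw [hint, hy t ht, hswap, ← hcomb]
  nth_rewrite 3 [← one_mul a]
  rw [← hzero]
  simp only [he]
  ring

/-! ### The bilinear estimate -/

lemma rpow_mul_self_le_of_le_add {p a b c : ℝ} (hp : -1 ≤ p) (hp' : p ≤ 0) (ha : 0 < a)
    (hb : 0 < b) (hc : 0 < c) (hcab : c ≤ a + b) : c ^ p * c ≤ a ^ p * b + b ^ p * a := by
  have h1 : ∀ x : ℝ, 0 < x → x ^ p * x = x ^ (p + 1) := fun x hx => by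
    rw [Real.rpow_add hx, Real.rpow_one]
  have h2 : c ^ p * c ≤ a ^ p * a + b ^ p * b := by
    rw [h1 a ha, h1 b hb, h1 c hc]
    exact (Real.rpow_le_rpow hc.le hcab (by linarith)).trans
      (Real.rpow_add_le_add_rpow ha.le hb.le (by linarith) (by linarith))
  have h3 : 0 ≤ (a ^ p - b ^ p) * (b - a) := by
    rcases le_total a b with h | h
    · exact mul_nonneg (sub_nonneg.2 (Real.rpow_le_rpow_of_nonpos ha h hp')) (sub_nonneg.2 h)
    · exact mul_nonneg_of_nonpos_of_nonpos
        (sub_nonpos.2 (Real.rpow_le_rpow_of_nonpos hb h hp')) (sub_nonpos.2 h)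
  nlinarith

lemma ae_ne_zero : ∀ᵐ ξ : E2, ξ ≠ 0 := by
  rw [ae_iff]; simp

lemma lintegral_lintegral_sub_mul {F G : E2 → ENNReal} (hF : Measurable F) (hG : Measurable G) :
    ∫⁻ ξ, ∫⁻ η, F (ξ - η) * G η = (∫⁻ ξ, F ξ) * ∫⁻ ξ, G ξ := by
  rw [lintegral_lintegral_swap (Measurable.aemeasurable (by fun_prop)),
    ← lintegral_const_mul _ hG]
  refine lintegral_congr fun η => ?_
  rw [lintegral_mul_const _ (by fun_prop), lintegral_sub_right_eq_self F η]

/-- The bilinear bound `‖∇·(uθ)‖_{X^p} ≤ 4 ‖θ‖_{X^p} ‖θ‖_{X^1}`, in terms of `G = |θ̂|`. -/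
lemma lintegral_convolution_le {p : ℝ} (hp : -1 ≤ p) (hp' : p ≤ 0) {G : E2 → ENNReal}
    (hG : Measurable G) :
    ∫⁻ ξ : E2, ENNReal.ofReal (‖ξ‖ ^ p) * (2 * ‖ξ‖ₑ * ∫⁻ η, G (ξ - η) * G η) ≤
      4 * (∫⁻ ξ, ENNReal.ofReal (‖ξ‖ ^ p) * G ξ) * ∫⁻ ξ, ‖ξ‖ₑ * G ξ := by
  set P : E2 → ENNReal := fun ξ => ENNReal.ofReal (‖ξ‖ ^ p) * G ξ with hP
  set Q : E2 → ENNReal := fun ξ => ‖ξ‖ₑ * G ξ with hQ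
  have hPm : Measurable P := by fun_prop
  have hQm : Measurable Q := by fun_prop
  have hpt : ∀ᵐ ξ : E2, ENNReal.ofReal (‖ξ‖ ^ p) * (2 * ‖ξ‖ₑ * ∫⁻ η, G (ξ - η) * G η) ≤
      2 * ((∫⁻ η, P (ξ - η) * Q η) + ∫⁻ η, Q (ξ - η) * P η) := by
    filter_upwards [ae_ne_zero] with ξ hξ
    rw [← lintegral_add_left (by fun_prop),
      show ENNReal.ofReal (‖ξ‖ ^ p) * (2 * ‖ξ‖ₑ * ∫⁻ η, G (ξ - η) * G η) =
        2 * ((ENNReal.ofReal (‖ξ‖ ^ p) * ‖ξ‖ₑ) * ∫⁻ η, G (ξ - η) * G η) by ring,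
      ← lintegral_const_mul _ (by fun_prop)]
    gcongr 2 * ?_
    refine lintegral_mono_ae ?_
    have hne : ∀ᵐ η : E2, η ≠ ξ := by rw [ae_iff]; simp
    filter_upwards [ae_ne_zero, hne] with η hη hηξ
    have key := rpow_mul_self_le_of_le_add hp hp' (norm_pos_iff.2 (sub_ne_zero.2 hηξ.symm))
      (norm_pos_iff.2 hη) (norm_pos_iff.2 hξ)
      (by simpa using norm_add_le (ξ - η) η)
    have key' : ENNReal.ofReal (‖ξ‖ ^ p) * ‖ξ‖ₑ ≤
        ENNReal.ofReal (‖ξ - η‖ ^ p) * ‖η‖ₑ + ENNReal.ofReal (‖η‖ ^ p) * ‖ξ - η‖ₑ := by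
      simp only [← ofReal_norm]
      rw [← ENNReal.ofReal_mul (by positivity), ← ENNReal.ofReal_mul (by positivity),
        ← ENNReal.ofReal_mul (by positivity), ← ENNReal.ofReal_add (by positivity) (by positivity)]
      exact ENNReal.ofReal_le_ofReal key
    calc _ ≤ (ENNReal.ofReal (‖ξ - η‖ ^ p) * ‖η‖ₑ + ENNReal.ofReal (‖η‖ ^ p) * ‖ξ - η‖ₑ) *
          (G (ξ - η) * G η) := by gcongr
      _ = _ := by simp only [hP, hQ]; ring
  refine (lintegral_mono_ae hpt).trans (le_of_eq ?_)
  have hm : Measurable fun ξ : E2 => ∫⁻ η, P (ξ - η) * Q η :=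
    Measurable.lintegral_prod_right' (f := fun x : E2 × E2 => P (x.1 - x.2) * Q x.2) (by fun_prop)
  rw [lintegral_const_mul' _ _ (by simp), lintegral_add_left hm,
    lintegral_lintegral_sub_mul hPm hQm, lintegral_lintegral_sub_mul hQm hPm]
  ring

lemma enorm_uhat_le (F : E2 → ℂ) (j : Fin 2) (η : E2) : ‖uhat F j η‖ₑ ≤ ‖F η‖ₑ := by
  have h : ∀ i : Fin 2, ‖η i / ‖η‖‖ ≤ 1 := fun i => by
    rw [norm_div, norm_norm]
    exact div_le_one_of_le₀ (PiLp.norm_apply_le η i) (norm_nonneg _)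
  rw [← ofReal_norm, ← ofReal_norm]
  refine ENNReal.ofReal_le_ofReal ?_
  unfold uhat
  split_ifs
  · rw [norm_mul, Complex.norm_real]
    exact mul_le_of_le_one_left (norm_nonneg _) (h 1)
  · rw [norm_mul, Complex.norm_real, neg_div, norm_neg]
    exact mul_le_of_le_one_left (norm_nonneg _) (h 0)

lemma enorm_Bhat_le (F : E2 → ℂ) (ξ : E2) :
    ‖Bhat F ξ‖ₑ ≤ 2 * ‖ξ‖ₑ * ∫⁻ η, ‖F (ξ - η)‖ₑ * ‖F η‖ₑ := by
  have hj : ∀ j : Fin 2, ‖(ξ j : ℂ) * ∫ η : E2, uhat F j (ξ - η) * F η‖ₑ ≤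
      ‖ξ‖ₑ * ∫⁻ η, ‖F (ξ - η)‖ₑ * ‖F η‖ₑ := by
    intro j
    rw [enorm_mul]
    gcongr
    · rw [← ofReal_norm, ← ofReal_norm, Complex.norm_real]
      exact ENNReal.ofReal_le_ofReal (PiLp.norm_apply_le ξ j)
    · refine (enorm_integral_le_lintegral_enorm _).trans (lintegral_mono fun η => ?_)
      rw [enorm_mul]
      gcongr
      exact enorm_uhat_le F j _
  unfold Bhat
  rw [enorm_mul, ← ofReal_norm Complex.I, Complex.norm_I, ENNReal.ofReal_one, one_mul,
    Fin.sum_univ_two]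
  refine (enorm_add_le _ _).trans ((add_le_add (hj 0) (hj 1)).trans (le_of_eq ?_))
  ring

lemma MemX.aemeasurable_enorm {σ : ℝ} {F : E2 → ℂ} (h : MemX σ F) :
    AEMeasurable fun ξ => ‖F ξ‖ₑ := by
  have h1 : AEMeasurable (fun ξ : E2 => ENNReal.ofReal (‖ξ‖ ^ (-σ) * (‖ξ‖ ^ σ * ‖F ξ‖))) :=
    ((measurable_norm.pow_const _).aemeasurable.mul h.aemeasurable).ennreal_ofReal
  refine h1.congr ?_
  filter_upwards [ae_ne_zero] with ξ hξ
  have : 0 < ‖ξ‖ := norm_pos_iff.2 hξ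
  rw [← mul_assoc, ← Real.rpow_add this, neg_add_cancel, Real.rpow_zero, one_mul, ofReal_norm]

lemma MemX.lintegral_eq {σ : ℝ} {F : E2 → ℂ} (h : MemX σ F) :
    ∫⁻ ξ : E2, ENNReal.ofReal (‖ξ‖ ^ σ) * ‖F ξ‖ₑ = ENNReal.ofReal (Xnorm σ F) := by
  unfold Xnorm
  rw [ofReal_integral_eq_lintegral_ofReal h (ae_of_all _ fun ξ => by positivity)]
  refine lintegral_congr fun ξ => ?_
  rw [ENNReal.ofReal_mul (by positivity), ofReal_norm]

lemma Xnorm_nonneg (σ : ℝ) (F : E2 → ℂ) : 0 ≤ Xnorm σ F :=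
  integral_nonneg fun ξ => by positivity

/-! ### The energy inequality -/

/-- Right-hand side of the Duhamel formula. -/
def duhamelRhs (α : ℝ) (Θ0 : E2 → ℂ) (Θ : ℝ → E2 → ℂ) (t : ℝ) (ξ : E2) : ℂ :=
  ((Real.exp (-t * ‖ξ‖ ^ (2*α)) : ℝ) : ℂ) * Θ0 ξ -
    ∫ s in (0:ℝ)..t, ((Real.exp (-(t - s) * ‖ξ‖ ^ (2*α)) : ℝ) : ℂ) * Bhat (Θ s) ξ

lemma duhamelRhs_eq (α : ℝ) (Θ0 : E2 → ℂ) (Θ : ℝ → E2 → ℂ) (t : ℝ) (ξ : E2) :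
    duhamelRhs α Θ0 Θ t ξ = ((Real.exp (-t * ‖ξ‖ ^ (2*α)) : ℝ) : ℂ) * (Θ0 ξ -
      ∫ s in (0:ℝ)..t, ((Real.exp (s * ‖ξ‖ ^ (2*α)) : ℝ) : ℂ) * Bhat (Θ s) ξ) := by
  unfold duhamelRhs
  rw [mul_sub, ← intervalIntegral.integral_const_mul]
  congr 2
  ext s
  rw [← mul_assoc, ← Complex.ofReal_mul, ← Real.exp_add]
  congr 4
  ring

lemma continuousAt_enorm_duhamelRhs_or (α : ℝ) (Θ0 : E2 → ℂ) (Θ : ℝ → E2 → ℂ) (ξ : E2)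
    {s t : ℝ} (hs : 0 < s) (hst : s < t) :
    ContinuousAt (fun r => ‖duhamelRhs α Θ0 Θ r ξ‖ₑ) s ∨
      ContinuousAt (fun r => ‖duhamelRhs α Θ0 Θ r ξ‖ₑ) t := by
  have h : ∀ t, ContinuousAt (fun r => ∫ s in (0:ℝ)..r,
      ((Real.exp (s * ‖ξ‖ ^ (2*α)) : ℝ) : ℂ) * Bhat (Θ s) ξ) t →
      ContinuousAt (fun r => ‖duhamelRhs α Θ0 Θ r ξ‖ₑ) t := by
    intro t ht
    simp only [duhamelRhs_eq]
    have h1 : Continuous fun r : ℝ => ((Real.exp (-r * ‖ξ‖ ^ (2*α)) : ℝ) : ℂ) := by fun_prop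
    exact (h1.continuousAt.mul (continuousAt_const.sub ht)).enorm
  exact (continuousAt_primitive_or hs hst).imp (h s) (h t)

/-- `‖θ(t)‖_{X^{1-2α}} + ∫₀ᵗ ‖θ‖_{X¹} ≤ ‖θ⁰‖_{X^{1-2α}} + 4 ∫₀ᵗ ‖θ‖_{X^{1-2α}} ‖θ‖_{X¹}`. -/
lemma energy_inequality {α : ℝ} (hα1 : 1/2 < α) (hα2 : α ≤ 1)
    {Θ0 : E2 → ℂ} (hΘ0 : MemX (1 - 2*α) Θ0) {Θ : ℝ → E2 → ℂ}
    (hmem : ∀ t : ℝ, 0 ≤ t → MemX (1 - 2*α) (Θ t)) (hmem1 : ∀ t : ℝ, 0 < t → MemX 1 (Θ t))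
    (hD : ∀ t : ℝ, 0 ≤ t → ∀ᵐ ξ : E2, Θ t ξ = duhamelRhs α Θ0 Θ t ξ) {t : ℝ} (ht : 0 ≤ t) :
    ENNReal.ofReal (Xnorm (1 - 2*α) (Θ t)) + ∫⁻ s in Ioc 0 t, ENNReal.ofReal (Xnorm 1 (Θ s)) ≤
      ENNReal.ofReal (Xnorm (1 - 2*α) Θ0) + ∫⁻ s in Ioc 0 t,
        4 * ENNReal.ofReal (Xnorm (1 - 2*α) (Θ s)) * ENNReal.ofReal (Xnorm 1 (Θ s)) := by
  have hmeas : ∀ t, 0 ≤ t → AEMeasurable fun ξ => ‖duhamelRhs α Θ0 Θ t ξ‖ₑ := fun t ht =>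
    (hmem t ht).aemeasurable_enorm.congr ((hD t ht).mono fun ξ h => congrArg _ h)
  obtain ⟨g, hg, hgξ, hgt⟩ := exists_measurable_version hmeas
    fun ξ s t hs hst => continuousAt_enorm_duhamelRhs_or α Θ0 Θ ξ hs hst
  have hsub : Ioc 0 t ⊆ Ioi (0 : ℝ) := fun s hs => hs.1
  have hgΘ : ∀ᵐ s ∂(volume.restrict (Ioc 0 t)), 0 < s ∧ ∀ᵐ ξ : E2, g (s, ξ) = ‖Θ s ξ‖ₑ := by
    filter_upwards [ae_restrict_mem measurableSet_Ioc, ae_restrict_of_ae_restrict_of_subset hsub hgt]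
      with s hs h
    refine ⟨hs.1, ?_⟩
    filter_upwards [h, hD s hs.1.le] with ξ h1 h2
    rw [h1, h2]
  set h : ℝ × E2 → ENNReal :=
    fun p => 2 * ‖p.2‖ₑ * ∫⁻ η, g (p.1, p.2 - η) * g (p.1, η) with hh
  have hh_meas : Measurable h := by
    have : Measurable fun p : ℝ × E2 => ∫⁻ η, g (p.1, p.2 - η) * g (p.1, η) :=
      Measurable.lintegral_prod_right'
        (f := fun q : (ℝ × E2) × E2 => g (q.1.1, q.1.2 - q.2) * g (q.1.1, q.2)) (by fun_prop)
    fun_prop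
  have hB : ∀ ξ, ∀ᵐ s ∂(volume.restrict (Ioc 0 t)), ‖Bhat (Θ s) ξ‖ₑ ≤ h (s, ξ) := by
    intro ξ
    filter_upwards [hgΘ] with s hs
    refine (enorm_Bhat_le _ _).trans (le_of_eq ?_)
    simp only [hh]
    congr 1
    refine lintegral_congr_ae ?_
    filter_upwards [hs.2, (quasiMeasurePreserving_sub_left volume ξ).ae hs.2] with η h1 h2
    rw [h1, h2]
  set y : E2 → ℝ → ENNReal := fun ξ r =>
    ENNReal.ofReal (Real.exp (-r * ‖ξ‖ ^ (2*α))) * ‖Θ0 ξ‖ₑ +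
      ∫⁻ s in Ioc 0 r, ENNReal.ofReal (Real.exp (-(r - s) * ‖ξ‖ ^ (2*α))) * h (s, ξ) with hy
  have hy_le : ∀ ξ, ∀ r ∈ Icc 0 t, ‖duhamelRhs α Θ0 Θ r ξ‖ₑ ≤ y ξ r := by
    intro ξ r hr
    have hexp : ∀ x : ℝ, ‖((Real.exp x : ℝ) : ℂ)‖ₑ = ENNReal.ofReal (Real.exp x) := fun x => by
      rw [← ofReal_norm, Complex.norm_real, Real.norm_of_nonneg (Real.exp_pos x).le]
    unfold duhamelRhs
    refine (enorm_sub_le).trans (add_le_add ?_ ?_)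
    · rw [enorm_mul, hexp]
    · rw [intervalIntegral.integral_of_le hr.1]
      refine (enorm_integral_le_lintegral_enorm _).trans (lintegral_mono_ae ?_)
      filter_upwards [ae_restrict_of_ae_restrict_of_subset (Ioc_subset_Ioc_right hr.2) (hB ξ)]
        with s hs
      rw [enorm_mul, hexp]
      gcongr
  have hpt : ∀ᵐ ξ : E2, ENNReal.ofReal (‖ξ‖ ^ (1 - 2*α)) * ‖Θ t ξ‖ₑ +
      ∫⁻ s in Ioc 0 t, ‖ξ‖ₑ * g (s, ξ) ≤ ENNReal.ofReal (‖ξ‖ ^ (1 - 2*α)) * ‖Θ0 ξ‖ₑ +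
        ∫⁻ s in Ioc 0 t, ENNReal.ofReal (‖ξ‖ ^ (1 - 2*α)) * h (s, ξ) := by
    filter_upwards [hgξ, hD t ht, ae_ne_zero] with ξ h1 h2 h3
    have hξ : 0 < ‖ξ‖ := norm_pos_iff.2 h3
    have hW : ‖ξ‖ₑ = ENNReal.ofReal (‖ξ‖ ^ (1 - 2*α)) * ENNReal.ofReal (‖ξ‖ ^ (2*α)) := by
      rw [← ENNReal.ofReal_mul (by positivity), ← Real.rpow_add hξ, ← ofReal_norm]
      simp
    have hint : ∫⁻ s in Ioc 0 t, g (s, ξ) ≤ ∫⁻ s in Ioc 0 t, y ξ s := by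
      refine lintegral_mono_ae ?_
      filter_upwards [ae_restrict_mem measurableSet_Ioc,
        ae_restrict_of_ae_restrict_of_subset hsub h1] with s hs h
      rw [h]
      exact hy_le ξ s ⟨hs.1.le, hs.2⟩
    rw [lintegral_const_mul _ (by fun_prop), lintegral_const_mul _ (by fun_prop), hW, mul_assoc,
      ← mul_add, ← mul_add]
    gcongr ENNReal.ofReal (‖ξ‖ ^ (1 - 2*α)) * ?_
    rw [← duhamel_add_lintegral (m := ‖ξ‖ ^ (2*α)) (by positivity) ht ‖Θ0 ξ‖ₑ
      (h := fun s => h (s, ξ)) (by fun_prop) (y := y ξ) (fun _ _ => rfl), h2]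
    gcongr
    exact hy_le ξ t ⟨ht, le_rfl⟩
  have hI := lintegral_mono_ae hpt
  have hm1 : Measurable fun ξ : E2 => ∫⁻ s in Ioc 0 t, ‖ξ‖ₑ * g (s, ξ) :=
    Measurable.lintegral_prod_right' (f := fun q : E2 × ℝ => ‖q.1‖ₑ * g (q.2, q.1)) (by fun_prop)
  have hm2 : Measurable fun ξ : E2 =>
      ∫⁻ s in Ioc 0 t, ENNReal.ofReal (‖ξ‖ ^ (1 - 2*α)) * h (s, ξ) :=
    Measurable.lintegral_prod_right'
      (f := fun q : E2 × ℝ => ENNReal.ofReal (‖q.1‖ ^ (1 - 2*α)) * h (q.2, q.1)) (by fun_prop)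
  rw [lintegral_add_right _ hm1, lintegral_add_right _ hm2, (hmem t ht).lintegral_eq,
    hΘ0.lintegral_eq, lintegral_lintegral_swap (by fun_prop),
    lintegral_lintegral_swap (μ := (volume : Measure E2)) (by fun_prop)] at hI
  have hX : ∀ᵐ s ∂(volume.restrict (Ioc 0 t)),
      ∫⁻ ξ : E2, ‖ξ‖ₑ * g (s, ξ) = ENNReal.ofReal (Xnorm 1 (Θ s)) := by
    filter_upwards [hgΘ] with s hs
    rw [← (hmem1 s hs.1).lintegral_eq]
    refine lintegral_congr_ae (hs.2.mono fun ξ h1 => ?_)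
    simp only [h1, Real.rpow_one, ofReal_norm]
  have hN : ∀ᵐ s ∂(volume.restrict (Ioc 0 t)),
      ∫⁻ ξ : E2, ENNReal.ofReal (‖ξ‖ ^ (1 - 2*α)) * h (s, ξ) ≤
        4 * ENNReal.ofReal (Xnorm (1 - 2*α) (Θ s)) * ENNReal.ofReal (Xnorm 1 (Θ s)) := by
    filter_upwards [hgΘ, hX] with s hs hXs
    rw [← hXs, ← (hmem s hs.1.le).lintegral_eq]
    refine (lintegral_convolution_le (p := 1 - 2*α) (by linarith) (by linarith)
      (G := fun ξ => g (s, ξ)) (by fun_prop)).trans (le_of_eq ?_)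
    congr 2
    exact lintegral_congr_ae (hs.2.mono fun ξ h1 => by simp only [h1])
  rw [lintegral_congr_ae hX] at hI
  refine hI.trans ?_
  gcongr 1
  exact lintegral_mono_ae hN

lemma energy_inequality_of_le {α : ℝ} (hα1 : 1/2 < α) (hα2 : α ≤ 1)
    {Θ0 : E2 → ℂ} (hΘ0 : MemX (1 - 2*α) Θ0) {Θ : ℝ → E2 → ℂ}
    (hmem : ∀ t : ℝ, 0 ≤ t → MemX (1 - 2*α) (Θ t)) (hmem1 : ∀ t : ℝ, 0 < t → MemX 1 (Θ t))
    (hD : ∀ t : ℝ, 0 ≤ t → ∀ᵐ ξ : E2, Θ t ξ = duhamelRhs α Θ0 Θ t ξ) {t : ℝ} (ht : 0 ≤ t)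
    (hint : IntegrableOn (fun s => Xnorm 1 (Θ s)) (Ioc 0 t)) {M : ℝ} (hM : 0 ≤ M)
    (hle : ∀ᵐ s ∂(volume.restrict (Ioc 0 t)), Xnorm (1 - 2*α) (Θ s) ≤ M) :
    Xnorm (1 - 2*α) (Θ t) + (1 - 4 * M) * ∫ s in (0:ℝ)..t, Xnorm 1 (Θ s) ≤
      Xnorm (1 - 2*α) Θ0 := by
  have hE := energy_inequality hα1 hα2 hΘ0 hmem hmem1 hD ht
  have hR : ∫⁻ s in Ioc 0 t,
      4 * ENNReal.ofReal (Xnorm (1 - 2*α) (Θ s)) * ENNReal.ofReal (Xnorm 1 (Θ s)) ≤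
      ENNReal.ofReal (4 * M) * ∫⁻ s in Ioc 0 t, ENNReal.ofReal (Xnorm 1 (Θ s)) := by
    rw [← lintegral_const_mul' _ _ ENNReal.ofReal_ne_top]
    refine lintegral_mono_ae (hle.mono fun s hs => ?_)
    rw [ENNReal.ofReal_mul (by norm_num), ENNReal.ofReal_ofNat]
    gcongr
  replace hE := hE.trans (add_le_add_right hR _)
  have hX0 : 0 ≤ ∫ s in Ioc 0 t, Xnorm 1 (Θ s) := integral_nonneg fun s => Xnorm_nonneg _ _
  rw [← ofReal_integral_eq_lintegral_ofReal hint (ae_of_all _ fun s => Xnorm_nonneg _ _),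
    ← ENNReal.ofReal_mul (by positivity), ← ENNReal.ofReal_add (Xnorm_nonneg _ _) hX0,
    ← ENNReal.ofReal_add (Xnorm_nonneg _ _) (by positivity),
    ENNReal.ofReal_le_ofReal_iff (add_nonneg (Xnorm_nonneg _ _) (by positivity))] at hE
  rw [intervalIntegral.integral_of_le ht]
  linarith

/-- A priori estimate: if `‖θ⁰‖_{X^{1-2α}} < 1/4` and `θ` solves the Duhamel
formulation of `(QG)_α` (with `k = 1`), then for all `t ≥ 0`
`‖θ(t)‖_{X^{1-2α}} + ((1-4‖θ⁰‖_{X^{1-2α}})/2) ∫₀ᵗ ‖θ(s)‖_{X¹} ds ≤ ‖θ⁰‖_{X^{1-2α}}`. -/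
theorem stmt_12 (α : ℝ) (hα1 : 1/2 < α) (hα2 : α ≤ 1)
    (Θ0 : E2 → ℂ) (hΘ0 : MemX (1 - 2*α) Θ0) (hsmall : Xnorm (1 - 2*α) Θ0 < 1/4)
    (Θ : ℝ → E2 → ℂ)
    (hmem : ∀ t : ℝ, 0 ≤ t → MemX (1 - 2*α) (Θ t))
    (hcont : Continuous fun t => Xnorm (1 - 2*α) (Θ t))
    (hmem1 : ∀ t : ℝ, 0 < t → MemX 1 (Θ t))
    (hloc : ∀ T : ℝ, 0 < T → IntegrableOn (fun s => Xnorm 1 (Θ s)) (Icc 0 T))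
    (hDuhamel : ∀ t : ℝ, 0 ≤ t → ∀ᵐ ξ : E2, Θ t ξ =
      ((Real.exp (-t * ‖ξ‖ ^ (2*α)) : ℝ) : ℂ) * Θ0 ξ -
        ∫ s in (0:ℝ)..t, ((Real.exp (-(t - s) * ‖ξ‖ ^ (2*α)) : ℝ) : ℂ) * Bhat (Θ s) ξ) :
    ∀ t : ℝ, 0 ≤ t →
      Xnorm (1 - 2*α) (Θ t) +
          ((1 - 4 * Xnorm (1 - 2*α) Θ0) / 2) * ∫ s in (0:ℝ)..t, Xnorm 1 (Θ s) ≤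
        Xnorm (1 - 2*α) Θ0 := by
  have hD : ∀ t : ℝ, 0 ≤ t → ∀ᵐ ξ : E2, Θ t ξ = duhamelRhs α Θ0 Θ t ξ := hDuhamel
  have hint : ∀ t : ℝ, 0 ≤ t → IntegrableOn (fun s => Xnorm 1 (Θ s)) (Ioc 0 t) := fun t ht =>
    (hloc (t + 1) (by linarith)).mono_set fun s hs => ⟨hs.1.le, hs.2.trans (by linarith)⟩
  have henergy : ∀ t : ℝ, 0 ≤ t → ∀ M : ℝ, 0 ≤ M →
      (∀ s ∈ Ioc 0 t, s < t → Xnorm (1 - 2*α) (Θ s) ≤ M) →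
      Xnorm (1 - 2*α) (Θ t) + (1 - 4 * M) * ∫ s in (0:ℝ)..t, Xnorm 1 (Θ s) ≤
        Xnorm (1 - 2*α) Θ0 := by
    intro t ht M hM hle
    refine energy_inequality_of_le hα1 hα2 hΘ0 hmem hmem1 hD ht (hint t ht) hM ?_
    have hne : ∀ᵐ s : ℝ, s ≠ t := by rw [ae_iff]; simp
    filter_upwards [ae_restrict_mem measurableSet_Ioc, ae_restrict_of_ae hne] with s hs hst
    exact hle s hs (lt_of_le_of_ne hs.2 hst)
  have hX1 : ∀ t : ℝ, 0 ≤ t → 0 ≤ ∫ s in (0:ℝ)..t, Xnorm 1 (Θ s) := fun t ht =>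
    intervalIntegral.integral_nonneg ht fun s _ => Xnorm_nonneg _ _
  have hlt : ∀ t : ℝ, 0 ≤ t → Xnorm (1 - 2*α) (Θ t) < 1/4 := by
    by_contra! hcon
    obtain ⟨t₁, ht₁, hbig⟩ := hcon
    have hcpt : IsCompact (Icc 0 t₁ ∩ {s | 1/4 ≤ Xnorm (1 - 2*α) (Θ s)}) :=
      isCompact_Icc.inter_right (isClosed_le continuous_const hcont)
    obtain ⟨τ, ⟨hτ, hτbig⟩, hτmin⟩ := hcpt.exists_isLeast ⟨t₁, ⟨ht₁, le_rfl⟩, hbig⟩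
    have h := henergy τ hτ.1 (1/4) (by norm_num) fun s hs hsτ => by
      by_contra! hs'
      exact absurd (hτmin ⟨⟨hs.1.le, hs.2.trans hτ.2⟩, hs'.le⟩) (not_le.2 hsτ)
    have hτbig' : 1/4 ≤ Xnorm (1 - 2*α) (Θ τ) := hτbig
    linarith
  have hbound : ∀ t : ℝ, 0 ≤ t → Xnorm (1 - 2*α) (Θ t) ≤ Xnorm (1 - 2*α) Θ0 := by
    intro t ht
    have h := henergy t ht (1/4) (by norm_num) fun s hs _ => (hlt s hs.1.le).le
    linarith
  intro t ht
  have h := henergy t ht _ (Xnorm_nonneg _ _) fun s hs _ => hbound s hs.1.le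
  nlinarith [hX1 t ht]
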